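/- Define T^{(a)}_m(u) := ξ^{(a)}_m(u − a − m + 1)/ξ(u − a − m + 1) for 0 ≤ a ≤ N+1 and m ≥ 0 (so T^{(a)}_0 ≡ 1). Then these functions solve the T-system for U_q(A^(2)_{2n}): for every u ∈ ℂ and every integer m ≥ 1, (i) T^{(a)}_m(u−1)·T^{(a)}_m(u+1) = T^{(a)}_{m−1}(u)·T^{(a)}_{m+1}(u) + T^{(a−1)}_m(u)·T^{(a+1)}_m(u) for 1 ≤ a ≤ n−1, and (ii) T^{(n)}_m(u−1)·T^{(n)}_m(u+1) = T^{(n)}_{m−1}(u)·T^{(n)}_{m+1}(u) + T^{(n−1)}_m(u)·T^{(n)}_m(u + s); moreover T^{(0)}_m ≡ 1. -/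

import Mathlib

open Complex

noncomputable def oneSubXD (x w : ℂ → ℂ) : ℂ → ℂ := fun u => w u - x u * w (u + 2)

noncomputable def Lop (x : ℕ → ℂ → ℂ) : ℕ → (ℂ → ℂ) → (ℂ → ℂ)
  | 0 => fun w => w
  | k + 1 => fun w => oneSubXD (x (k + 1)) (Lop x k w)

noncomputable def casorati (N : ℕ) (w : ℕ → ℂ → ℂ) (idx : ℕ → ℕ) (u : ℂ) : ℂ :=
  Matrix.det (Matrix.of fun j k : Fin (N + 1) => w (j.1 + 1) (u + 2 * (idx k.1 : ℂ)))

noncomputable def DsubF (f w : ℂ → ℂ) : ℂ → ℂ := fun u => w (u + 2) - f u * w u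

noncomputable def Lfac (f : ℕ → ℂ → ℂ) (Nv : ℕ) : ℕ → (ℂ → ℂ) → (ℂ → ℂ)
  | 0 => fun w => w
  | a + 1 => fun w => DsubF (f (Nv + 1 - a)) (Lfac f Nv a w)

/-- The coefficient of `w (u + 2 * i)` in `Lop x k w u`. -/
noncomputable def opCoeff (x : ℕ → ℂ → ℂ) : ℕ → ℤ → ℂ → ℂ
  | 0, i, _ => if i = 0 then 1 else 0
  | k + 1, i, u => opCoeff x k i u - x (k + 1) u * opCoeff x k (i - 1) (u + 2)

theorem opCoeff_of_neg (x : ℕ → ℂ → ℂ) (k : ℕ) {i : ℤ} (hi : i < 0) (u : ℂ) :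
    opCoeff x k i u = 0 := by
  induction k generalizing i u with
  | zero => simp [opCoeff, hi.ne]
  | succ k ih => rw [opCoeff, ih hi, ih (by omega)]; ring

theorem opCoeff_of_lt (x : ℕ → ℂ → ℂ) (k : ℕ) {i : ℤ} (hi : (k : ℤ) < i) (u : ℂ) :
    opCoeff x k i u = 0 := by
  induction k generalizing i u with
  | zero => simp only [opCoeff]; rw [if_neg (by omega)]
  | succ k ih =>
    push_cast at hi
    rw [opCoeff, ih (by omega), ih (by omega)]; ring

theorem opCoeff_zero_right (x : ℕ → ℂ → ℂ) (k : ℕ) (u : ℂ) : opCoeff x k 0 u = 1 := by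
  induction k generalizing u with
  | zero => simp [opCoeff]
  | succ k ih => rw [opCoeff, ih, opCoeff_of_neg x k (by omega)]; ring

theorem opCoeff_succ_self (x : ℕ → ℂ → ℂ) (k : ℕ) (u : ℂ) :
    opCoeff x (k + 1) ((k + 1 : ℕ) : ℤ) u = -(x (k + 1) u * opCoeff x k k (u + 2)) := by
  rw [opCoeff, opCoeff_of_lt x k (by omega)]
  push_cast
  rw [add_sub_cancel_right]; ring

theorem Lop_eq_sum (x : ℕ → ℂ → ℂ) (k : ℕ) (w : ℂ → ℂ) (u : ℂ) :
    Lop x k w u = ∑ i ∈ Finset.range (k + 1), opCoeff x k i u * w (u + 2 * i) := by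
  induction k generalizing u with
  | zero => simp [Lop, opCoeff]
  | succ k ih =>
    have h1 : ∑ i ∈ Finset.range (k + 2), opCoeff x k i u * w (u + 2 * i)
        = ∑ i ∈ Finset.range (k + 1), opCoeff x k i u * w (u + 2 * i) := by
      rw [Finset.sum_range_succ, opCoeff_of_lt x k (by push_cast; omega)]; ring
    have h2 : ∑ i ∈ Finset.range (k + 2), opCoeff x k ((i : ℤ) - 1) (u + 2) * w (u + 2 * i)
        = ∑ i ∈ Finset.range (k + 1), opCoeff x k i (u + 2) * w (u + 2 + 2 * i) := by
      rw [Finset.sum_range_succ', opCoeff_of_neg x k (by simp), zero_mul, add_zero]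
      refine Finset.sum_congr rfl fun i _ => ?_
      push_cast
      congr 2 <;> ring
    simp only [Lop, oneSubXD, ih]
    rw [← h1, ← h2, Finset.mul_sum, ← Finset.sum_sub_distrib]
    refine Finset.sum_congr rfl fun i _ => ?_
    rw [opCoeff]; ring

/-- Splitting off the innermost factor instead of the outermost one. -/
theorem opCoeff_succ_right (x : ℕ → ℂ → ℂ) (k : ℕ) (i : ℤ) (u : ℂ) :
    opCoeff x (k + 1) i u = opCoeff (fun b => x (b + 1)) k i u
      - opCoeff (fun b => x (b + 1)) k (i - 1) u * x 1 (u + 2 * ((i : ℂ) - 1)) := by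
  induction k generalizing i u with
  | zero =>
    simp only [opCoeff]
    by_cases hi : i - 1 = 0
    · obtain rfl : i = 1 := by omega
      simp
    · simp [hi]
  | succ k ih =>
    rw [opCoeff, ih, ih]
    simp only [opCoeff]
    push_cast
    rw [show u + 2 + 2 * ((i : ℂ) - 1 - 1) = u + 2 * ((i : ℂ) - 1) by ring]
    ring

/-- `Lfac` is, up to a shift of the argument, the formal adjoint of `Lop`. -/
theorem Lfac_eq_sum (x : ℕ → ℂ → ℂ) (N a : ℕ) (ha : a ≤ N + 1) (s : ℂ) (w : ℂ → ℂ) (u : ℂ) :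
    Lfac (fun c v => x c (v + (N : ℂ) + 1 - 2 * c + s)) N a w u
      = ∑ i ∈ Finset.range (a + 1),
          opCoeff (fun b => x (N + 1 - a + b)) a ((a : ℤ) - i) (u + 2 * i + s - N - 1)
            * w (u + 2 * i) := by
  induction a generalizing u with
  | zero => simp [Lfac, opCoeff]
  | succ a ih =>
    set y : ℕ → ℂ → ℂ := fun b => x (N + 1 - a + b) with hy
    have hstep : ∀ (i : ℤ) (v : ℂ), opCoeff (fun b => x (N + 1 - (a + 1) + b)) (a + 1) i v
        = opCoeff y a i v - opCoeff y a (i - 1) v * x (N + 1 - a) (v + 2 * ((i : ℂ) - 1)) := by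
      intro i v
      rw [opCoeff_succ_right]
      have e1 : (fun b => x (N + 1 - (a + 1) + (b + 1))) = y := by
        funext b
        rw [hy, show N + 1 - (a + 1) + (b + 1) = N + 1 - a + b by omega]
      rw [e1, show N + 1 - (a + 1) + 1 = N + 1 - a by omega]
    have h1 : ∑ i ∈ Finset.range (a + 2),
          opCoeff y a ((a : ℤ) - i) (u + 2 * i + s - N - 1) * w (u + 2 * i)
        = ∑ i ∈ Finset.range (a + 1),
          opCoeff y a ((a : ℤ) - i) (u + 2 * i + s - N - 1) * w (u + 2 * i) := by
      rw [Finset.sum_range_succ, opCoeff_of_neg y a (by push_cast; omega)]; ring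
    have h2 : ∑ i ∈ Finset.range (a + 2),
          opCoeff y a ((a : ℤ) + 1 - i) (u + 2 * i + s - N - 1) * w (u + 2 * i)
        = ∑ i ∈ Finset.range (a + 1),
          opCoeff y a ((a : ℤ) - i) (u + 2 + 2 * i + s - N - 1) * w (u + 2 + 2 * i) := by
      rw [Finset.sum_range_succ', opCoeff_of_lt y a (by simp), zero_mul, add_zero]
      refine Finset.sum_congr rfl fun i _ => ?_
      push_cast
      rw [show (a : ℤ) + 1 - (i + 1) = a - i by ring,
        show u + 2 * ((i : ℂ) + 1) = u + 2 + 2 * i by ring]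
    simp only [Lfac, DsubF, ih (by omega)]
    rw [← h1, ← h2, Finset.mul_sum, ← Finset.sum_sub_distrib]
    refine Finset.sum_congr rfl fun i _ => ?_
    rw [hstep]
    push_cast [Nat.cast_sub (show a ≤ N + 1 by omega)]
    rw [show (a : ℤ) + 1 - i - 1 = a - i by ring,
      show u + 2 * (i : ℂ) + s - N - 1 + 2 * ((a : ℂ) + 1 - i - 1)
        = u + N + 1 - 2 * (N + 1 - a) + s by ring]
    ring

/-- Complementary minors of matrices with orthogonal rows are proportional. -/
theorem det_mul_det_of_mul_transpose_eq_zero {ι κ K : Type*} [Fintype ι] [Fintype κ] [Fintype K]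
    [DecidableEq ι] [DecidableEq κ] [DecidableEq K] {F : Type*} [CommRing F]
    (C : Matrix ι K F) (R : Matrix κ K F) (h : C * R.transpose = 0) (e e' : ι ⊕ κ ≃ K) :
    (C.submatrix id (e ∘ Sum.inl)).det * (R.submatrix id (e' ∘ Sum.inr)).det
      = (Equiv.Perm.sign (e.trans e'.symm) : F)
        * ((C.submatrix id (e' ∘ Sum.inl)).det * (R.submatrix id (e ∘ Sum.inr)).det) := by
  set M : Matrix (ι ⊕ κ) K F :=
    Matrix.fromRows C ((1 : Matrix K K F).submatrix (e ∘ Sum.inr) id)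
  set B : Matrix K (ι ⊕ κ) F :=
    Matrix.fromCols ((1 : Matrix K K F).submatrix id (e' ∘ Sum.inl)) R.transpose
  have hM : (M.submatrix id e).det = (C.submatrix id (e ∘ Sum.inl)).det := by
    have : M.submatrix id e = Matrix.fromBlocks (C.submatrix id (e ∘ Sum.inl))
        (C.submatrix id (e ∘ Sum.inr)) 0 1 := by
      ext (i | i) (j | j) <;> simp [M, Matrix.one_apply]
    rw [this, Matrix.det_fromBlocks_zero₂₁, Matrix.det_one, mul_one]
  have hB : (B.submatrix e' id).det = (R.submatrix id (e' ∘ Sum.inr)).det := by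
    have : B.submatrix e' id = Matrix.fromBlocks 1
        (R.transpose.submatrix (e' ∘ Sum.inl) id) 0 (R.submatrix id (e' ∘ Sum.inr)).transpose := by
      ext (i | i) (j | j) <;> simp [B, Matrix.one_apply]
    rw [this, Matrix.det_fromBlocks_zero₂₁, Matrix.det_one, one_mul, Matrix.det_transpose]
  have hB' : (B.submatrix e id).det
      = (Equiv.Perm.sign (e.trans e'.symm) : F) * (B.submatrix e' id).det := by
    rw [← Matrix.det_permute]
    congr 1
    ext i j
    simp
  have hMB : M * B = Matrix.fromBlocks (C.submatrix id (e' ∘ Sum.inl)) 0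
      ((1 : Matrix K K F).submatrix (e ∘ Sum.inr) (e' ∘ Sum.inl))
      (R.submatrix id (e ∘ Sum.inr)).transpose := by
    rw [Matrix.fromRows_mul_fromCols, h]
    congr 1
    · ext i j; simp [Matrix.mul_apply, Matrix.one_apply]
    · ext i j; simp [Matrix.mul_apply, Matrix.one_apply]
    · ext i j; simp [Matrix.mul_apply, Matrix.one_apply]
  have hprod : (M.submatrix id e).det * (B.submatrix e id).det = (M * B).det := by
    rw [← Matrix.det_mul, Matrix.submatrix_mul_equiv, Matrix.submatrix_id_id]
  rw [hM, hB', hB, hMB, Matrix.det_fromBlocks_zero₁₂, Matrix.det_transpose] at hprod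
  have hs : (Equiv.Perm.sign (e.trans e'.symm) : F)
      * (Equiv.Perm.sign (e.trans e'.symm) : F) = 1 := by
    rw [← Int.cast_mul, ← Units.val_mul, Int.units_mul_self]; simp
  rw [← hprod]
  linear_combination (-(C.submatrix id (e ∘ Sum.inl)).det
    * (R.submatrix id (e' ∘ Sum.inr)).det) * hs

/-- The column exchange (Plücker) relation for determinants. -/
theorem det_mul_det_eq_sum_updateCol {ι F : Type*} [Fintype ι] [DecidableEq ι] [CommRing F]
    (A B : Matrix ι ι F) (j : ι) :
    A.det * B.det = ∑ k, (A.updateCol k (fun i => B i j)).det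
      * (B.updateCol j (fun i => A i k)).det := by
  have h := congrArg (fun v => B.cramer v j) (Matrix.mulVec_cramer A (fun i => B i j))
  have hB : B.cramer (fun i => B i j) j = B.det := by
    rw [Matrix.cramer_apply]
    congr 1
    exact Matrix.updateCol_eq_self B j
  simp only [map_smul, Pi.smul_apply, hB, smul_eq_mul] at h
  rw [← h]
  have hv : A.mulVec (A.cramer fun i => B i j)
      = ∑ k, (A.updateCol k (fun i => B i j)).det • fun i => A i k := by
    ext i
    simp [Matrix.mulVec, dotProduct, Matrix.cramer_apply, mul_comm]
  rw [hv, map_sum, Finset.sum_apply]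
  refine Finset.sum_congr rfl fun k _ => ?_
  rw [map_smul, Pi.smul_apply, smul_eq_mul, Matrix.cramer_apply]

/-- The determinant of the columns `c i`, `i` running through `idx`. -/
noncomputable def colMinor {N : ℕ} (c : ℕ → Fin (N + 1) → ℂ) (idx : Fin (N + 1) → ℕ) : ℂ :=
  Matrix.det (Matrix.of fun j k => c (idx k) j)

theorem casorati_eq_colMinor (N : ℕ) (w : ℕ → ℂ → ℂ) (idx : ℕ → ℕ) (u : ℂ) :
    casorati N w idx u = colMinor (N := N) (fun i j => w (j + 1) (u + 2 * i)) (fun k => idx k) :=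
  rfl

theorem casorati_add_two (N : ℕ) (w : ℕ → ℂ → ℂ) (idx : ℕ → ℕ) (u : ℂ) :
    casorati N w idx (u + 2) = casorati N w (fun k => idx k + 1) u := by
  simp only [casorati]
  congr 1
  ext j k
  simp only [Matrix.of_apply]
  push_cast
  congr 1; ring

theorem colMinor_mul_colMinor {N : ℕ} (c : ℕ → Fin (N + 1) → ℂ) (f g : Fin (N + 1) → ℕ)
    (j : Fin (N + 1)) :
    colMinor c f * colMinor c g = ∑ k, colMinor c (Function.update f k (g j))
      * colMinor c (Function.update g j (f k)) := by
  have hupd : ∀ (f : Fin (N + 1) → ℕ) (k : Fin (N + 1)) (i : ℕ),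
      (Matrix.of fun j k => c (f k) j).updateCol k (c i)
        = Matrix.of fun j l => c (Function.update f k i l) j := by
    intro f k i
    ext p q
    by_cases h : q = k
    · subst h; simp
    · simp [h]
  unfold colMinor
  rw [det_mul_det_eq_sum_updateCol _ _ j]
  refine Finset.sum_congr rfl fun k _ => ?_
  rw [← hupd, ← hupd]
  rfl

theorem colMinor_comp_perm {N : ℕ} (c : ℕ → Fin (N + 1) → ℂ) (f : Fin (N + 1) → ℕ)
    (σ : Equiv.Perm (Fin (N + 1))) :
    colMinor c (f ∘ σ) = (Equiv.Perm.sign σ : ℂ) * colMinor c f := by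
  unfold colMinor
  rw [← Matrix.det_permute']
  rfl

theorem colMinor_eq_zero {N : ℕ} (c : ℕ → Fin (N + 1) → ℂ) (f : Fin (N + 1) → ℕ)
    {i j : Fin (N + 1)} (hij : i ≠ j) (h : f i = f j) : colMinor c f = 0 :=
  Matrix.det_zero_of_column_eq hij fun p => by simp [h]

/-- The three-term Plücker relation behind the T-system. -/
theorem casorati_plucker (N : ℕ) (w : ℕ → ℂ → ℂ) (a m : ℕ) (ha : a + 1 ≤ N) (p : ℂ) :
    casorati N w (fun k => if k < a + 1 then k else k + (m + 1)) p
        * casorati N w (fun k => if k < a + 1 then k else k + (m + 1)) (p + 2)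
      = casorati N w (fun k => if k < a + 1 then k else k + m) (p + 2)
          * casorati N w (fun k => if k < a + 1 then k else k + (m + 2)) p
        + casorati N w (fun k => if k < a then k else k + (m + 1)) (p + 2)
          * casorati N w (fun k => if k < a + 2 then k else k + (m + 1)) p := by
  rw [casorati_add_two, casorati_add_two, casorati_add_two]
  simp only [casorati_eq_colMinor]
  set c : ℕ → Fin (N + 1) → ℂ := fun i j => w (j + 1) (p + 2 * i)
  set j : Fin (N + 1) := ⟨a, by omega⟩ with hj
  set j' : Fin (N + 1) := ⟨a + 1, by omega⟩ with hj'
  rw [colMinor_mul_colMinor c _ _ j]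
  rw [Finset.sum_eq_add (0 : Fin (N + 1)) j' (by simp [hj', Fin.ext_iff])]
  · congr 1
    · set σ := Fin.cycleRange j
      have h2 : Function.update (fun k : Fin (N + 1) =>
            (if (k : ℕ) < a + 1 then (k : ℕ) else k + (m + 1)) + 1) j
            (if ((0 : Fin (N + 1)) : ℕ) < a + 1 then ((0 : Fin (N + 1)) : ℕ)
              else ((0 : Fin (N + 1)) : ℕ) + (m + 1))
          = (fun k : Fin (N + 1) => if (k : ℕ) < a + 1 then (k : ℕ) else k + (m + 2)) ∘ σ := by
        funext k
        rcases lt_trichotomy k j with h | h | h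
        · have h' : (k : ℕ) < a := h
          simp only [Function.update_of_ne h.ne, Function.comp, σ, Fin.coe_cycleRange_of_lt h]
          split_ifs <;> omega
        · subst h; simp [σ]
        · have h' : a < (k : ℕ) := h
          simp only [Function.update_of_ne h.ne', Function.comp, σ, Fin.cycleRange_of_gt h]
          split_ifs <;> omega
      have h1 : (fun k : Fin (N + 1) => (if (k : ℕ) < a + 1 then (k : ℕ) else k + m) + 1)
          = Function.update (fun k : Fin (N + 1) =>
              if (k : ℕ) < a + 1 then (k : ℕ) else k + (m + 1)) 0
            ((if (j : ℕ) < a + 1 then (j : ℕ) else j + (m + 1)) + 1) ∘ σ := by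
        funext k
        rcases lt_trichotomy k j with h | h | h
        · have h' : (k : ℕ) < a := h
          have hne : σ k ≠ 0 := by
            rw [Ne, Fin.ext_iff, Fin.coe_cycleRange_of_lt h]; simp
          simp only [Function.comp, Function.update_of_ne hne, σ, Fin.coe_cycleRange_of_lt h]
          split_ifs <;> omega
        · subst h; simp [σ, hj]
        · have h' : a < (k : ℕ) := h
          have hne : k ≠ 0 := by
            rintro rfl; simp at h'
          simp only [Function.comp, σ, Fin.cycleRange_of_gt h, Function.update_of_ne hne]
          split_ifs <;> omega
      rw [h1, h2, colMinor_comp_perm, colMinor_comp_perm]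
      ring
    · rw [mul_comm]
      congr 2
      · funext k
        by_cases h : k = j
        · subst h; simp [hj, hj']; ring
        · have h' : (k : ℕ) ≠ a := fun e => h (Fin.ext e)
          rw [Function.update_of_ne h]
          split_ifs <;> omega
      · funext k
        by_cases h : k = j'
        · subst h; simp [hj, hj']
        · have h' : (k : ℕ) ≠ a + 1 := fun e => h (Fin.ext e)
          rw [Function.update_of_ne h]
          split_ifs <;> omega
  · rintro k - ⟨hk0, hk⟩
    have hk0' : (k : ℕ) ≠ 0 := fun e => hk0 (Fin.ext e)
    have hk' : (k : ℕ) ≠ a + 1 := fun e => hk (Fin.ext e)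
    have hlt := k.isLt
    refine mul_eq_zero_of_right _ ?_
    set i : Fin (N + 1) := ⟨k - 1, by omega⟩ with hi
    have hij : i ≠ j := by
      simp only [hi, hj, Ne, Fin.ext_iff]; omega
    refine colMinor_eq_zero c _ hij ?_
    rw [Function.update_of_ne hij, Function.update_self]
    simp only [hi]
    split_ifs <;> omega
  · simp
  · simp

/-- The full Casorati determinant is periodic. -/
theorem casorati_id_add_two (N : ℕ) (hN : Even N) (w : ℕ → ℂ → ℂ) (l : ℤ → ℂ → ℂ)
    (hl0 : ∀ u, l 0 u = 1) (hlN : ∀ u, l (N + 1) u = -1)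
    (hrel : ∀ b, 1 ≤ b → b ≤ N + 1 → ∀ u : ℂ,
      ∑ i ∈ Finset.range (N + 2), l i u * w b (u + 2 * i) = 0) (u : ℂ) :
    casorati N w (fun k => k) (u + 2) = casorati N w (fun k => k) u := by
  set K : Matrix (Fin (N + 1)) (Fin (N + 1)) ℂ := Matrix.of fun j k =>
    if (k : ℕ) < N then (if (j : ℕ) = k + 1 then 1 else 0) else l j u
  have hK : K.det = 1 := by
    rw [Matrix.det_succ_row_zero, Finset.sum_eq_single (Fin.last N)]
    · have h1 : K.submatrix Fin.succ (Fin.last N).succAbove = 1 := by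
        ext i j
        simp [K, Matrix.one_apply, Fin.ext_iff]
      rw [h1, Matrix.det_one]
      simp [K, hl0, hN.neg_one_pow]
    · intro k _ hk
      have : (k : ℕ) < N := Fin.val_lt_last hk
      simp [K, this]
    · simp
  unfold casorati
  rw [← mul_one (Matrix.det (Matrix.of fun j k : Fin (N + 1) => w (j.1 + 1) (u + 2 * (k.1 : ℂ)))),
    ← hK, ← Matrix.det_mul]
  congr 1
  ext j k
  rw [Matrix.mul_apply]
  simp only [Matrix.of_apply, K]
  by_cases hk : (k : ℕ) < N
  · rw [Finset.sum_eq_single ⟨k + 1, by omega⟩]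
    · simp only [hk, if_true, mul_one]
      push_cast
      congr 1; ring
    · intro i _ hi
      have : (i : ℕ) ≠ k + 1 := fun e => hi (Fin.ext e)
      simp [hk, this]
    · simp
  · have hkN : (k : ℕ) = N := by omega
    have h := hrel (j + 1) (by omega) (by omega) u
    rw [Finset.sum_range_succ, Finset.sum_range] at h
    push_cast at h
    rw [hlN] at h
    simp only [hkN, lt_irrefl, if_false]
    rw [show u + 2 + 2 * (N : ℂ) = u + 2 * (N + 1) by ring]
    simp only [mul_comm (w _ _)]
    linear_combination -h

/-- The equivalence sending the first summand to the increasing enumeration of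
`{0, …, N + m} \ {a, …, a + m - 1}` and the second one to that of `{a, …, a + m - 1}`. -/
noncomputable def blockEquiv (N m a : ℕ) (ha : a ≤ N + 1) :
    Fin (N + 1) ⊕ Fin m ≃ Fin (N + 1 + m) :=
  Equiv.ofBijective
    (Sum.elim (fun k => ⟨if (k : ℕ) < a then k else k + m, by split_ifs <;> omega⟩)
      (fun j => ⟨a + j, by omega⟩))
    ((Fintype.bijective_iff_injective_and_card _).2 ⟨by
      rintro (i | i) (j | j) h <;> simp only [Sum.elim_inl, Sum.elim_inr, Fin.mk.injEq] at h
      · congr 1; ext; split_ifs at h <;> omega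
      · exfalso; split_ifs at h <;> omega
      · exfalso; split_ifs at h <;> omega
      · congr 1; ext; omega, by simp⟩)

theorem blockEquiv_inl (N m a : ℕ) (ha : a ≤ N + 1) (k : Fin (N + 1)) :
    (blockEquiv N m a ha (Sum.inl k) : ℕ) = if (k : ℕ) < a then (k : ℕ) else k + m := rfl

theorem blockEquiv_inr (N m a : ℕ) (ha : a ≤ N + 1) (j : Fin m) :
    (blockEquiv N m a ha (Sum.inr j) : ℕ) = a + j := rfl

/-- Jacobi–Trudi formula for Casorati minors with an arbitrary arrangement of the columns. -/
theorem det_casorati_eq (N m : ℕ) (w : ℕ → ℂ → ℂ) (l : ℤ → ℂ → ℂ)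
    (hlN : ∀ u, l (N + 1) u = -1) (hneg : ∀ i < 0, ∀ u, l i u = 0)
    (hgt : ∀ i : ℤ, (N : ℤ) + 1 < i → ∀ u, l i u = 0)
    (hrel : ∀ b, 1 ≤ b → b ≤ N + 1 → ∀ u : ℂ,
      ∑ i ∈ Finset.range (N + 2), l i u * w b (u + 2 * i) = 0) (u : ℂ)
    (e : Fin (N + 1) ⊕ Fin m ≃ Fin (N + 1 + m)) :
    (-1) ^ m * Matrix.det (Matrix.of fun j k : Fin (N + 1) =>
        w (j + 1) (u + 2 * ((e (Sum.inl k) : ℕ) : ℂ)))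
      = (Equiv.Perm.sign (e.trans (blockEquiv N m (N + 1) le_rfl).symm) : ℂ)
        * (casorati N w (fun k => k) u
          * Matrix.det (Matrix.of fun k j : Fin m =>
              l (((e (Sum.inr j) : ℕ) : ℤ) - k) (u + 2 * k))) := by
  set C : Matrix (Fin (N + 1)) (Fin (N + 1 + m)) ℂ := Matrix.of fun j i =>
    w (j + 1) (u + 2 * ((i : ℕ) : ℂ))
  set R : Matrix (Fin m) (Fin (N + 1 + m)) ℂ := Matrix.of fun k i =>
    l (((i : ℕ) : ℤ) - k) (u + 2 * k)
  have hCR : C * R.transpose = 0 := by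
    ext j k
    rw [Matrix.mul_apply]
    simp only [C, R, Matrix.of_apply, Matrix.transpose_apply, Matrix.zero_apply]
    rw [← Finset.sum_range (fun i => w (j + 1) (u + 2 * (i : ℂ)) * l ((i : ℤ) - k) (u + 2 * k)),
      show N + 1 + m = k + (N + 2) + (m - 1 - k) by omega, Finset.sum_range_add,
      Finset.sum_range_add]
    have h1 : ∀ i ∈ Finset.range (k : ℕ),
        w (j + 1) (u + 2 * (i : ℂ)) * l ((i : ℤ) - k) (u + 2 * k) = 0 := by
      intro i hi
      rw [Finset.mem_range] at hi
      rw [hneg _ (by omega), mul_zero]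
    have h3 : ∀ i ∈ Finset.range (m - 1 - k), w (j + 1) (u + 2 * ((k + (N + 2) + i : ℕ) : ℂ))
        * l (((k + (N + 2) + i : ℕ) : ℤ) - k) (u + 2 * k) = 0 := by
      intro i _
      rw [hgt _ (by push_cast; omega), mul_zero]
    rw [Finset.sum_eq_zero h1, Finset.sum_eq_zero h3, zero_add, add_zero,
      ← hrel (j + 1) (by omega) (by omega) (u + 2 * k)]
    refine Finset.sum_congr rfl fun i _ => ?_
    push_cast
    rw [show (k : ℤ) + i - k = i by ring, mul_comm]
    congr 2; ring
  have h := det_mul_det_of_mul_transpose_eq_zero C R hCR e (blockEquiv N m (N + 1) le_rfl)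
  have hR : (R.submatrix id (blockEquiv N m (N + 1) le_rfl ∘ Sum.inr)).det = (-1) ^ m := by
    rw [Matrix.det_of_isLowerTriangular]
    · simp [R, blockEquiv_inr, hlN]
    · intro i j hij
      have : (i : ℕ) < j := hij
      simp only [R, Matrix.submatrix_apply, Function.comp, Matrix.of_apply, blockEquiv_inr]
      exact hgt _ (by push_cast; simp only [id]; omega) _
  have hC : (C.submatrix id (blockEquiv N m (N + 1) le_rfl ∘ Sum.inl)).det
      = casorati N w (fun k => k) u := by
    unfold casorati
    congr 1
    ext j k
    simp only [C, Matrix.submatrix_apply, Function.comp, Matrix.of_apply, blockEquiv_inl, k.isLt,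
      if_true, id]
  rw [hR, hC] at h
  rw [mul_comm]
  exact h

/-- Self-duality of the difference operator identifies the Casorati minors attached to the nodes
`n + 1` and `n`. -/
theorem casorati_duality (n N q : ℕ) (hN : N = 2 * n) (w : ℕ → ℂ → ℂ) (l : ℤ → ℂ → ℂ) (s : ℂ)
    (hlN : ∀ u, l (N + 1) u = -1) (hneg : ∀ i < 0, ∀ u, l i u = 0)
    (hgt : ∀ i : ℤ, (N : ℤ) + 1 < i → ∀ u, l i u = 0)
    (hrel : ∀ b, 1 ≤ b → b ≤ N + 1 → ∀ u : ℂ,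
      ∑ i ∈ Finset.range (N + 2), l i u * w b (u + 2 * i) = 0)
    (hdual : ∀ (i : ℤ) (u : ℂ), l (N + 1 - i) u = -l i (u + N + 1 - 2 * i + s)) (p : ℂ) :
    casorati N w (fun k => if k < n + 1 then k else k + (q + 1)) p
        * casorati N w (fun k => k) (p + 1 + s)
      = casorati N w (fun k => if k < n then k else k + (q + 1)) (p + 1 + s)
        * casorati N w (fun k => k) p := by
  set e := blockEquiv N (q + 1) n (by omega) with he
  set k₀ : Fin (N + 1) := ⟨n, by omega⟩ with hk₀
  set τ : Equiv.Perm (Fin (N + 1) ⊕ Fin (q + 1)) := Equiv.swap (Sum.inl k₀) (Sum.inr 0) with hτ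
  set ε : ℂ := (Equiv.Perm.sign (e.trans (blockEquiv N (q + 1) (N + 1) le_rfl).symm) : ℂ) with hε
  have hsign : (Equiv.Perm.sign
      ((τ.trans e).trans (blockEquiv N (q + 1) (N + 1) le_rfl).symm) : ℂ) = -ε := by
    rw [Equiv.trans_assoc, Equiv.Perm.sign_trans, hτ, Equiv.Perm.sign_swap (by simp)]
    simp [hε]
  have h1 := det_casorati_eq N (q + 1) w l hlN hneg hgt hrel (p + 1 + s) e
  have h2 := det_casorati_eq N (q + 1) w l hlN hneg hgt hrel p (τ.trans e)
  rw [hsign] at h2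
  have hC1 : Matrix.det (Matrix.of fun j k : Fin (N + 1) =>
        w (j + 1) (p + 1 + s + 2 * ((e (Sum.inl k) : ℕ) : ℂ)))
      = casorati N w (fun k => if k < n then k else k + (q + 1)) (p + 1 + s) := by
    simp only [casorati, he, blockEquiv_inl]
  have hC2 : Matrix.det (Matrix.of fun j k : Fin (N + 1) =>
        w (j + 1) (p + 2 * (((τ.trans e) (Sum.inl k) : ℕ) : ℂ)))
      = casorati N w (fun k => if k < n + 1 then k else k + (q + 1)) p := by
    unfold casorati
    congr 1
    ext j k
    have : ((τ.trans e) (Sum.inl k) : ℕ) = if (k : ℕ) < n + 1 then (k : ℕ) else k + (q + 1) := by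
      rw [Equiv.trans_apply, hτ]
      by_cases hk : k = k₀
      · subst hk
        rw [Equiv.swap_apply_left, he, blockEquiv_inr]
        simp [hk₀]
      · have hk' : (k : ℕ) ≠ n := fun h => hk (Fin.ext h)
        rw [Equiv.swap_apply_of_ne_of_ne (by simpa using hk) (by simp), he, blockEquiv_inl]
        split_ifs <;> omega
    simp only [Matrix.of_apply, this]
  have hR : Matrix.det (Matrix.of fun k j : Fin (q + 1) =>
        l ((((τ.trans e) (Sum.inr j) : ℕ) : ℤ) - k) (p + 2 * k))
      = - Matrix.det (Matrix.of fun k j : Fin (q + 1) =>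
        l (((e (Sum.inr j) : ℕ) : ℤ) - k) (p + 1 + s + 2 * k)) := by
    set A := Matrix.of fun k j : Fin (q + 1) =>
      l (((e (Sum.inr j) : ℕ) : ℤ) - k) (p + 1 + s + 2 * k) with hA
    have hidx : ∀ j : Fin (q + 1), ((τ.trans e) (Sum.inr (finRotate (q + 1) j)) : ℕ)
        = n + 1 + j := by
      intro j
      rw [Equiv.trans_apply, hτ]
      by_cases hj : j = Fin.last q
      · subst hj
        rw [finRotate_last, Equiv.swap_apply_right, he, blockEquiv_inl]
        simp [hk₀]; ring
      · have hv := coe_finRotate_of_ne_last hj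
        have h0 : finRotate (q + 1) j ≠ 0 := by
          intro h
          rw [h] at hv
          simp at hv
        rw [Equiv.swap_apply_of_ne_of_ne (by simp) (by simpa using h0), he, blockEquiv_inr, hv]
        ring
    have hmat : (Matrix.of fun k j : Fin (q + 1) =>
        l ((((τ.trans e) (Sum.inr j) : ℕ) : ℤ) - k) (p + 2 * k)).submatrix id (finRotate (q + 1))
        = (-A).transpose := by
      ext k j
      simp only [Matrix.submatrix_apply, Matrix.of_apply, hidx, id, Matrix.transpose_apply,
        Matrix.neg_apply, hA]
      have he_inr : (e (Sum.inr k) : ℕ) = n + k := rfl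
      rw [he_inr]
      have h := hdual (n + k - j) (p + 2 * k)
      rw [show (N : ℤ) + 1 - (n + k - j) = n + 1 + j - k by rw [hN]; push_cast; ring] at h
      push_cast
      rw [h, hN]
      congr 2
      push_cast; ring
    have hdet := Matrix.det_permute' (finRotate (q + 1)) (Matrix.of fun k j : Fin (q + 1) =>
        l ((((τ.trans e) (Sum.inr j) : ℕ) : ℤ) - k) (p + 2 * k))
    rw [hmat, Matrix.det_transpose, Matrix.det_neg, sign_finRotate, Fintype.card_fin] at hdet
    push_cast at hdet
    have hsq : ((-1 : ℂ) ^ q) * (-1) ^ q = 1 := by rw [← mul_pow]; simp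
    rw [pow_succ] at hdet
    linear_combination (-(-1 : ℂ) ^ q) * hdet - (Matrix.det (Matrix.of fun k j : Fin (q + 1) =>
        l ((((τ.trans e) (Sum.inr j) : ℕ) : ℤ) - k) (p + 2 * k)) + A.det) * hsq
  rw [hC1] at h1
  rw [hC2, hR] at h2
  have hne : ((-1 : ℂ) ^ (q + 1)) ≠ 0 := pow_ne_zero _ (by norm_num)
  apply mul_left_cancel₀ hne
  linear_combination casorati N w (fun k => k) (p + 1 + s) * h2
    - casorati N w (fun k => k) p * h1

/-- An operator whose kernel is, up to a shift, annihilated by its formal adjoint is self-dual. -/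
theorem opCoeff_dual (N : ℕ) (x w : ℕ → ℂ → ℂ) (s : ℂ)
    (hlN : ∀ u, opCoeff x (N + 1) (N + 1) u = -1)
    (hrel : ∀ b, 1 ≤ b → b ≤ N + 1 → ∀ u : ℂ,
      ∑ i ∈ Finset.range (N + 2), opCoeff x (N + 1) i u * w b (u + 2 * i) = 0)
    (hLfac : ∀ b : ℕ, 1 ≤ b → b ≤ N + 1 → ∀ u : ℂ,
      Lfac (fun c v => x c (v + (N : ℂ) + 1 - 2 * c + s)) N (N + 1) (w b) u = 0)
    (hxi : ∀ u : ℂ, casorati N w (fun k => k) u ≠ 0) (i : ℤ) (u : ℂ) :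
    opCoeff x (N + 1) (N + 1 - i) u = -opCoeff x (N + 1) i (u + N + 1 - 2 * i + s) := by
  have hrel' : ∀ b, 1 ≤ b → b ≤ N + 1 →
      ∑ i ∈ Finset.range (N + 2), opCoeff x (N + 1) ((N : ℤ) + 1 - i) (u + 2 * i + s - N - 1)
        * w b (u + 2 * i) = 0 := by
    intro b h1 h2
    have h := hLfac b h1 h2 u
    rw [Lfac_eq_sum x N (N + 1) le_rfl] at h
    simpa using h
  have hlast : ∀ v v' : ℂ, opCoeff x (N + 1) ((N : ℤ) + 1 - ((N + 1 : ℕ) : ℤ)) v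
      + opCoeff x (N + 1) ((N + 1 : ℕ) : ℤ) v' = 0 := by
    intro v v'
    push_cast
    rw [sub_self, opCoeff_zero_right, hlN]; ring
  have hvec : (fun k : Fin (N + 1) => opCoeff x (N + 1) ((N : ℤ) + 1 - k) (u + 2 * k + s - N - 1)
      + opCoeff x (N + 1) k u) = 0 := by
    refine Matrix.eq_zero_of_mulVec_eq_zero (hxi u) ?_
    ext j
    have h1 := hrel (j + 1) (by omega) (by omega) u
    have h2 := hrel' (j + 1) (by omega) (by omega)
    have h := congrArg₂ (· + ·) h1 h2
    simp only [← Finset.sum_add_distrib, ← add_mul] at h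
    rw [Finset.sum_range_succ, add_comm (opCoeff x (N + 1) ((N + 1 : ℕ) : ℤ) u), hlast,
      zero_mul, add_zero, Finset.sum_range, add_zero] at h
    rw [Pi.zero_apply, ← h]
    simp only [Matrix.mulVec, dotProduct, Matrix.of_apply]
    refine Finset.sum_congr rfl fun k _ => ?_
    ring
  have hnat : ∀ k : ℕ, k ≤ N + 1 →
      opCoeff x (N + 1) ((N : ℤ) + 1 - k) (u + 2 * k + s - N - 1) + opCoeff x (N + 1) k u = 0 := by
    intro k hk
    rcases hk.lt_or_eq with h | rfl
    · exact congrFun hvec ⟨k, h⟩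
    · exact hlast _ _
  by_cases h0 : i < 0
  · rw [opCoeff_of_neg x _ h0, opCoeff_of_lt x _ (by push_cast; omega), neg_zero]
  by_cases h1 : (N : ℤ) + 1 < i
  · rw [opCoeff_of_neg x _ (by omega), opCoeff_of_lt x _ (by push_cast; omega), neg_zero]
  obtain ⟨k, hk⟩ : ∃ k : ℕ, (k : ℤ) = N + 1 - i := ⟨(N + 1 - i).toNat, by omega⟩
  have h := hnat k (by omega)
  have hi : i = N + 1 - k := by omega
  rw [← hk, hi, eq_neg_iff_add_eq_zero, add_comm, ← h]
  congr 2
  push_cast; ring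

theorem opCoeff_top_eq_neg_one (n : ℕ) (s : ℂ) (Y x : ℕ → ℂ → ℂ) (hY0 : ∀ u, Y 0 u = 1)
    (hYne : ∀ a ≤ n, ∀ u, Y a u ≠ 0)
    (hxa : ∀ a, 1 ≤ a → a ≤ n → ∀ u : ℂ, x a u = Y a (u + a) / Y (a - 1) (u + a + 1))
    (hx0 : ∀ u : ℂ, x (n + 1) u = Y n (u + n + 1 + s) / Y n (u + n + 2))
    (hxbar : ∀ a, 1 ≤ a → a ≤ n → ∀ u : ℂ,
      x (2 * n - a + 2) u = Y (a - 1) (u + 2 * (n : ℂ) - a + 2 + s)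
        / Y a (u + 2 * (n : ℂ) - a + 3 + s)) (u : ℂ) :
    opCoeff x (2 * n + 1) ((2 * n + 1 : ℕ) : ℤ) u = -1 := by
  have h1 : ∀ k ≤ n, ∀ u, opCoeff x k k u = (-1) ^ k * Y k (u + k) := by
    intro k
    induction k with
    | zero => intro _ u; simp [opCoeff, hY0]
    | succ k ih =>
      intro hk u
      rw [opCoeff_succ_self, ih (by omega), hxa (k + 1) (by omega) hk]
      have h := hYne k (by omega) (u + 2 + k)
      rw [Nat.add_sub_cancel]
      push_cast
      rw [show u + ((k : ℂ) + 1) + 1 = u + 2 + k by ring]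
      field_simp
      ring
  have h2 : ∀ c ≤ n, ∀ u, opCoeff x (n + 1 + c) ((n + 1 + c : ℕ) : ℤ) u
      = (-1) ^ (n + 1 + c) * Y (n - c) (u + n + c + 1 + s) := by
    intro c
    induction c with
    | zero =>
      intro _ u
      have h := hYne n le_rfl (u + 2 + n)
      rw [add_zero, opCoeff_succ_self, h1 n le_rfl, hx0, show u + n + 2 = u + 2 + (n : ℂ) by ring,
        Nat.sub_zero, Nat.cast_zero, add_zero]
      field_simp
      ring
    | succ c ih =>
      intro hc u
      have hx := hxbar (n - c) (by omega) (by omega) u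
      rw [show 2 * n - (n - c) + 2 = n + 1 + c + 1 by omega, show n - c - 1 = n - (c + 1) by omega,
        Nat.cast_sub (by omega : c ≤ n)] at hx
      have h := hYne (n - c) (by omega) (u + 2 + n + c + 1 + s)
      rw [← add_assoc, opCoeff_succ_self, ih (by omega), hx,
        show u + 2 * (n : ℂ) - (n - c) + 3 + s = u + 2 + n + c + 1 + s by ring,
        show u + 2 * (n : ℂ) - (n - c) + 2 + s = u + n + (c + 1 : ℕ) + 1 + s by push_cast; ring]
      field_simp
      ring
  have h := h2 n le_rfl u
  rw [show n + 1 + n = 2 * n + 1 by ring, Nat.sub_self, hY0, pow_succ, pow_mul] at h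
  simpa using h

theorem Tsystem_A2_even
    (n : ℕ) (hn : 1 ≤ n) (N : ℕ) (hN : N = 2 * n)
    (hbar : ℂ) (hbar_ne : hbar ≠ 0) (s : ℂ)
    (hs : s = (Real.pi : ℂ) * Complex.I / (2 * hbar))
    (Q : ℕ → ℂ → ℂ) (hQ0 : ∀ u, Q 0 u = 1)
    (hQne : ∀ a, 1 ≤ a → a ≤ n → ∀ u, Q a u ≠ 0)
    (hconst : ℕ → ℂ)
    (hQper : ∀ a, 1 ≤ a → a ≤ n → hconst a ≠ 0 ∧
      ∀ u, Q a (u + (Real.pi : ℂ) * Complex.I / hbar) = hconst a * Q a u)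
    (Y : ℕ → ℂ → ℂ) (hY : ∀ a u, Y a u = Q a (u - 1) / Q a (u + 1))
    (x : ℕ → ℂ → ℂ)
    (hxa : ∀ a, 1 ≤ a → a ≤ n → ∀ u : ℂ,
      x a u = Y a (u + a) / Y (a - 1) (u + a + 1))
    (hx0 : ∀ u : ℂ, x (n + 1) u = Y n (u + n + 1 + s) / Y n (u + n + 2))
    (hxbar : ∀ a, 1 ≤ a → a ≤ n → ∀ u : ℂ,
      x (2 * n - a + 2) u = Y (a - 1) (u + 2 * (n : ℂ) - a + 2 + s)
        / Y a (u + 2 * (n : ℂ) - a + 3 + s))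
    (w : ℕ → ℂ → ℂ)
    (hw : ∀ b, 1 ≤ b → b ≤ N + 1 → ∀ u : ℂ, Lop x (N + 1) (w b) u = 0)
    (hLfac : ∀ a b : ℕ, 1 ≤ b → b ≤ a → a ≤ N + 1 → ∀ u : ℂ,
      Lfac (fun c v => x c (v + (N : ℂ) + 1 - 2 * c + s)) N a (w b) u = 0)
    (hxi : ∀ u : ℂ, casorati N w (fun k => k) u ≠ 0)
    (Tf : ℕ → ℕ → ℂ → ℂ)
    (hTf : ∀ a m : ℕ, ∀ u : ℂ, Tf a m u
      = casorati N w (fun k => if k < a then k else k + m) (u - a - m + 1)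
        / casorati N w (fun k => k) (u - a - m + 1))
    :
    (∀ m : ℕ, 1 ≤ m → ∀ a : ℕ, 1 ≤ a → a ≤ n - 1 → ∀ u : ℂ,
      Tf a m (u - 1) * Tf a m (u + 1)
        = Tf a (m - 1) u * Tf a (m + 1) u + Tf (a - 1) m u * Tf (a + 1) m u) ∧
    (∀ m : ℕ, 1 ≤ m → ∀ u : ℂ,
      Tf n m (u - 1) * Tf n m (u + 1)
        = Tf n (m - 1) u * Tf n (m + 1) u + Tf (n - 1) m u * Tf n m (u + s)) ∧
    (∀ m : ℕ, ∀ u : ℂ, Tf 0 m u = 1) := by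
  have hY0 : ∀ u, Y 0 u = 1 := by simp [hY, hQ0]
  have hYne : ∀ a ≤ n, ∀ u, Y a u ≠ 0 := by
    intro a ha u
    rcases Nat.eq_zero_or_pos a with rfl | h
    · simp [hY0]
    · rw [hY]
      exact div_ne_zero (hQne a h ha _) (hQne a h ha _)
  have htop : ∀ u, opCoeff x (N + 1) (N + 1) u = -1 := by
    intro u
    subst hN
    exact opCoeff_top_eq_neg_one n s Y x hY0 hYne hxa hx0 hxbar u
  have hrel : ∀ b, 1 ≤ b → b ≤ N + 1 → ∀ u : ℂ,
      ∑ i ∈ Finset.range (N + 2), opCoeff x (N + 1) i u * w b (u + 2 * i) = 0 := by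
    intro b h1 h2 u
    rw [← Lop_eq_sum]
    exact hw b h1 h2 u
  have hperiod : ∀ u, casorati N w (fun k => k) (u + 2) = casorati N w (fun k => k) u :=
    casorati_id_add_two N (hN ▸ even_two_mul n) w _ (opCoeff_zero_right x (N + 1)) htop hrel
  have hdual := opCoeff_dual N x w s htop hrel (fun b h1 h2 => hLfac (N + 1) b h1 h2 le_rfl) hxi
  have hTsystem : ∀ m a : ℕ, a + 1 ≤ N → ∀ u : ℂ,
      Tf (a + 1) (m + 1) (u - 1) * Tf (a + 1) (m + 1) (u + 1)
        = Tf (a + 1) m u * Tf (a + 1) (m + 2) u + Tf a (m + 1) u * Tf (a + 2) (m + 1) u := by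
    intro m a ha u
    have hP := casorati_plucker N w a m ha (u - a - m - 2)
    have hp := hperiod (u - a - m - 2)
    have hne := hxi (u - a - m - 2)
    simp only [hTf]
    push_cast
    rw [show u - 1 - ((a : ℂ) + 1) - (m + 1) + 1 = u - a - m - 2 by ring,
      show u + 1 - ((a : ℂ) + 1) - (m + 1) + 1 = u - a - m - 2 + 2 by ring,
      show u - ((a : ℂ) + 1) - m + 1 = u - a - m - 2 + 2 by ring,
      show u - ((a : ℂ) + 1) - (m + 2) + 1 = u - a - m - 2 by ring,
      show u - (a : ℂ) - (m + 1) + 1 = u - a - m - 2 + 2 by ring,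
      show u - ((a : ℂ) + 2) - (m + 1) + 1 = u - a - m - 2 by ring, hp]
    field_simp
    linear_combination hP
  have hduality : ∀ (q : ℕ) (u : ℂ), Tf (n + 1) (q + 1) u = Tf n (q + 1) (u + s) := by
    intro q u
    rw [hTf, hTf, div_eq_div_iff (hxi _) (hxi _)]
    have h := casorati_duality n N q hN w (opCoeff x (N + 1)) s htop
      (fun i hi => opCoeff_of_neg x (N + 1) hi)
      (fun i hi => opCoeff_of_lt x (N + 1) (by push_cast; exact hi)) hrel hdual (u - n - q - 1)
    push_cast
    rw [show u - ((n : ℂ) + 1) - (q + 1) + 1 = u - n - q - 1 by ring,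
      show u + s - (n : ℂ) - (q + 1) + 1 = u - n - q - 1 + 1 + s by ring]
    exact h
  refine ⟨?_, ?_, ?_⟩
  · intro m hm a ha han u
    obtain ⟨m, rfl⟩ := Nat.exists_eq_succ_of_ne_zero (by omega : m ≠ 0)
    obtain ⟨a, rfl⟩ := Nat.exists_eq_succ_of_ne_zero (by omega : a ≠ 0)
    exact hTsystem m a (by omega) u
  · intro m hm u
    obtain ⟨m, rfl⟩ := Nat.exists_eq_succ_of_ne_zero (by omega : m ≠ 0)
    rw [Nat.succ_eq_add_one, ← hduality m u]
    obtain ⟨a, rfl⟩ := Nat.exists_eq_succ_of_ne_zero (by omega : n ≠ 0)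
    exact hTsystem m a (by omega) u
  · intro m u
    have hshift : ∀ v, casorati N w (fun k => if k < 0 then k else k + m) v
        = casorati N w (fun k => k) v := by
      intro v
      simp only [Nat.not_lt_zero, if_false]
      induction m generalizing v with
      | zero => rfl
      | succ m ih =>
        rw [← hperiod v, ← ih (v + 2), casorati_add_two]
        rfl
    rw [hTf, hshift, div_self (hxi _)]
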